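/- Let d ≥ 1, 1 < p < ∞, δ ∈ ℝ, and let m ≥ 0 be an integer. Assume either mp < d and p ≤ q ≤ dp/(d−mp), or mp = d and p ≤ q < ∞. Then there exists a constant C = C(d,m,p,q,δ) such that for every f ∈ C_c^∞(ℝ^d), (∫_{ℝ^d} (⟨x⟩^δ |f(x)|)^q dx)^{1/q} ≤ C · Σ_{|α|≤m} (∫_{ℝ^d} (⟨x⟩^δ |D^α f(x)|)^p dx)^{1/p}. -/

import Mathlib

open MeasureTheory Filter
open scoped BigOperators ENNReal Topology

noncomputable section

/-- The Japanese bracket `⟨x⟩ = (1+|x|²)^{1/2}`. -/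
def jb {d : ℕ} (x : EuclideanSpace ℝ (Fin d)) : ℝ := Real.sqrt (1 + ‖x‖ ^ 2)

/-- The partial derivative in the `i`-th coordinate direction. -/
def pd {d : ℕ} {F : Type*} [NormedAddCommGroup F] [NormedSpace ℝ F] (i : Fin d)
    (f : EuclideanSpace ℝ (Fin d) → F) : EuclideanSpace ℝ (Fin d) → F :=
  fun x => fderiv ℝ f x (EuclideanSpace.single i 1)

/-- Iterated partial derivatives along a list of coordinate directions. -/
def pdList {d : ℕ} {F : Type*} [NormedAddCommGroup F] [NormedSpace ℝ F] :
    List (Fin d) → (EuclideanSpace ℝ (Fin d) → F) → EuclideanSpace ℝ (Fin d) → F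
  | [], f => f
  | i :: l, f => pd i (pdList l f)

/-- The partial derivative `D^α f` corresponding to a multi-index `α : Fin d → ℕ`. -/
def mD {d : ℕ} {F : Type*} [NormedAddCommGroup F] [NormedSpace ℝ F] (α : Fin d → ℕ)
    (f : EuclideanSpace ℝ (Fin d) → F) : EuclideanSpace ℝ (Fin d) → F :=
  pdList ((List.finRange d).flatMap fun i => List.replicate (α i) i) f

/-- The order `|α|` of a multi-index. -/
def msize {d : ℕ} (α : Fin d → ℕ) : ℕ := ∑ i, α i

/-- The finset of all multi-indices on `ℝ^d` of order at most `m`. -/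
def mIdx (d m : ℕ) : Finset (Fin d → ℕ) :=
  (Fintype.piFinset fun _ : Fin d => Finset.range (m + 1)).filter fun α => msize α ≤ m

open scoped NNReal

lemma one_le_jb {d : ℕ} (x : EuclideanSpace ℝ (Fin d)) : 1 ≤ jb x := by
  rw [jb, Real.one_le_sqrt]
  nlinarith [sq_nonneg ‖x‖]

lemma jb_pos {d : ℕ} (x : EuclideanSpace ℝ (Fin d)) : 0 < jb x :=
  zero_lt_one.trans_le (one_le_jb x)

lemma jb_rpow_eq {d : ℕ} (δ : ℝ) (x : EuclideanSpace ℝ (Fin d)) :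
    jb x ^ δ = (1 + ‖x‖ ^ 2) ^ (δ / 2) := by
  rw [jb, Real.sqrt_eq_rpow, ← Real.rpow_mul (by positivity)]
  congr 1
  ring

lemma contDiff_jb_rpow {d : ℕ} (δ : ℝ) :
    ContDiff ℝ (⊤ : ℕ∞) fun x : EuclideanSpace ℝ (Fin d) => jb x ^ δ := by
  simp_rw [jb_rpow_eq]
  exact (contDiff_const.add (contDiff_norm_sq ℝ)).rpow_const_of_ne fun x => by positivity

lemma norm_fderiv_jb_rpow_le {d : ℕ} (δ : ℝ) (x : EuclideanSpace ℝ (Fin d)) :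
    ‖fderiv ℝ (fun y : EuclideanSpace ℝ (Fin d) => jb y ^ δ) x‖ ≤ |δ| * jb x ^ δ := by
  have hpos : 0 < 1 + ‖x‖ ^ 2 := by positivity
  have h1 : HasFDerivAt (fun y : EuclideanSpace ℝ (Fin d) => 1 + ‖y‖ ^ 2)
      (2 • innerSL ℝ x) x := by
    simpa using (hasStrictFDerivAt_norm_sq x).hasFDerivAt.const_add 1
  have h2 := h1.rpow_const (p := δ / 2) (Or.inl hpos.ne')
  simp_rw [jb_rpow_eq]
  rw [h2.fderiv, norm_smul, ← Nat.cast_smul_eq_nsmul ℝ, norm_smul, innerSL_apply_norm,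
    Real.norm_eq_abs, abs_mul, abs_of_pos (Real.rpow_pos_of_pos hpos _), abs_div,
    Real.rpow_sub_one hpos.ne']
  have hx : ‖x‖ ≤ 1 + ‖x‖ ^ 2 := by nlinarith [sq_nonneg (‖x‖ - 1), norm_nonneg x]
  have hw := Real.rpow_pos_of_pos hpos (δ / 2)
  calc |δ| / |2| * ((1 + ‖x‖ ^ 2) ^ (δ / 2) / (1 + ‖x‖ ^ 2)) * (‖((2 : ℕ) : ℝ)‖ * ‖x‖)
      = |δ| * (1 + ‖x‖ ^ 2) ^ (δ / 2) * (‖x‖ / (1 + ‖x‖ ^ 2)) := by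
        simp
        ring
    _ ≤ |δ| * (1 + ‖x‖ ^ 2) ^ (δ / 2) * 1 := by
        gcongr
        exact (div_le_one hpos).2 hx
    _ = _ := mul_one _

lemma norm_fderiv_le_sum_abs_pd {d : ℕ} (g : EuclideanSpace ℝ (Fin d) → ℝ)
    (x : EuclideanSpace ℝ (Fin d)) : ‖fderiv ℝ g x‖ ≤ ∑ i, |pd i g x| := by
  refine ContinuousLinearMap.opNorm_le_bound _ (by positivity) fun v => ?_
  have hv : v = ∑ i, v i • EuclideanSpace.single i (1 : ℝ) := by
    simpa using ((EuclideanSpace.basisFun (Fin d) ℝ).sum_repr v).symm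
  calc ‖fderiv ℝ g x v‖ = ‖∑ i, v i * pd i g x‖ := by
        conv_lhs => rw [hv]
        simp [map_sum, pd]
    _ ≤ ∑ i, ‖v i * pd i g x‖ := norm_sum_le _ _
    _ ≤ ∑ i, |pd i g x| * ‖v‖ := by
        gcongr with i
        rw [norm_mul, mul_comm, Real.norm_eq_abs (pd i g x)]
        gcongr
        exact PiLp.norm_apply_le v i
    _ = _ := by rw [Finset.sum_mul]

lemma ContDiff.pd {d : ℕ} {g : EuclideanSpace ℝ (Fin d) → ℝ} (hg : ContDiff ℝ (⊤ : ℕ∞) g)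
    (i : Fin d) : ContDiff ℝ (⊤ : ℕ∞) (pd i g) :=
  (hg.fderiv_right (by simp)).clm_apply contDiff_const

lemma HasCompactSupport.pd {d : ℕ} {g : EuclideanSpace ℝ (Fin d) → ℝ}
    (hg : HasCompactSupport g) (i : Fin d) : HasCompactSupport (pd i g) :=
  (hg.fderiv ℝ).comp_left (g := fun L : EuclideanSpace ℝ (Fin d) →L[ℝ] ℝ =>
    L (EuclideanSpace.single i 1)) rfl

lemma ContDiff.pdList {d : ℕ} {g : EuclideanSpace ℝ (Fin d) → ℝ} (hg : ContDiff ℝ (⊤ : ℕ∞) g)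
    (l : List (Fin d)) : ContDiff ℝ (⊤ : ℕ∞) (pdList l g) := by
  induction l with
  | nil => exact hg
  | cons i l ih => exact ih.pd i

lemma HasCompactSupport.pdList {d : ℕ} {g : EuclideanSpace ℝ (Fin d) → ℝ}
    (hg : HasCompactSupport g) (l : List (Fin d)) : HasCompactSupport (pdList l g) := by
  induction l with
  | nil => exact hg
  | cons i l ih => exact ih.pd i

lemma pd_comm {d : ℕ} {g : EuclideanSpace ℝ (Fin d) → ℝ} (hg : ContDiff ℝ (⊤ : ℕ∞) g)
    (i j : Fin d) : pd i (pd j g) = pd j (pd i g) := by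
  have hd : Differentiable ℝ (fderiv ℝ g) :=
    (hg.fderiv_right (m := (⊤ : ℕ∞)) (by simp)).differentiable (by simp)
  have key : ∀ a b x, pd a (pd b g) x =
      fderiv ℝ (fderiv ℝ g) x (EuclideanSpace.single a 1) (EuclideanSpace.single b 1) := by
    intro a b x
    unfold pd
    rw [fderiv_clm_apply (hd x) (differentiableAt_const _)]
    simp
  funext x
  rw [key, key]
  exact (hg.contDiffAt.isSymmSndFDerivAt
    (by simpa using WithTop.coe_le_coe.2 (le_top : (2 : ℕ∞) ≤ ⊤))).eq _ _

lemma pdList_append_singleton {d : ℕ} (g : EuclideanSpace ℝ (Fin d) → ℝ) (l : List (Fin d))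
    (i : Fin d) : pdList (l ++ [i]) g = pdList l (pd i g) := by
  induction l with
  | nil => rfl
  | cons j l ih => simp [pdList, ih]

lemma pdList_congr_perm {d : ℕ} {g : EuclideanSpace ℝ (Fin d) → ℝ}
    (hg : ContDiff ℝ (⊤ : ℕ∞) g) {l l' : List (Fin d)} (h : l.Perm l') :
    pdList l g = pdList l' g := by
  induction h with
  | nil => rfl
  | cons i _ ih => simp only [pdList, ih]
  | swap i j l => exact pd_comm (hg.pdList l) _ _
  | trans _ _ h₁ h₂ => exact h₁.trans h₂

lemma mD_count_eq_pdList {d : ℕ} {g : EuclideanSpace ℝ (Fin d) → ℝ}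
    (hg : ContDiff ℝ (⊤ : ℕ∞) g) (l : List (Fin d)) :
    mD (fun i => l.count i) g = pdList l g := by
  refine pdList_congr_perm hg (List.perm_iff_count.2 fun a => ?_)
  rw [List.count_flatMap, Function.comp_def]
  simp only [List.count_replicate, beq_iff_eq]
  rw [← List.ofFn_eq_map, List.sum_ofFn]
  simp

lemma count_mem_mIdx {d m : ℕ} {l : List (Fin d)} (hl : l.length ≤ m) :
    (fun i => l.count i) ∈ mIdx d m := by
  refine Finset.mem_filter.2 ⟨Fintype.mem_piFinset.2 fun i => Finset.mem_range.2
    (Nat.lt_succ_of_le (List.count_le_length.trans hl)), le_of_eq_of_le ?_ hl⟩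
  rw [msize]
  simpa using Multiset.sum_count_eq_card (s := Finset.univ) (m := (l : Multiset (Fin d)))
    fun _ _ => Finset.mem_univ _

/-- The weighted Lebesgue norm `‖⟨x⟩^δ g‖_{L^p}`. -/
def wLp {d : ℕ} (δ : ℝ) (p : ℝ≥0) (g : EuclideanSpace ℝ (Fin d) → ℝ) : ℝ≥0∞ :=
  eLpNorm (fun x => jb x ^ δ * g x) p volume

lemma memLp_jb_rpow_mul {d : ℕ} (δ : ℝ) (p : ℝ≥0) {g : EuclideanSpace ℝ (Fin d) → ℝ}
    (hg : Continuous g) (hgc : HasCompactSupport g) :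
    MemLp (fun x => jb x ^ δ * g x) p volume :=
  ((contDiff_jb_rpow δ).continuous.mul hg).memLp_of_hasCompactSupport hgc.mul_left

lemma toReal_wLp {d : ℕ} (δ : ℝ) {p : ℝ≥0} (hp : p ≠ 0) {g : EuclideanSpace ℝ (Fin d) → ℝ}
    (hg : Continuous g) (hgc : HasCompactSupport g) :
    (∫ x, (jb x ^ δ * |g x|) ^ (p : ℝ)) ^ (1 / (p : ℝ)) = (wLp δ p g).toReal := by
  rw [wLp, (memLp_jb_rpow_mul δ p hg hgc).eLpNorm_eq_integral_rpow_norm (by simpa using hp)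
    ENNReal.coe_ne_top, ENNReal.toReal_ofReal (by positivity)]
  simp [abs_of_pos (Real.rpow_pos_of_pos (jb_pos _) δ)]

lemma eLpNorm_fderiv_jb_rpow_mul_le {d : ℕ} (δ : ℝ) {p : ℝ≥0} (hp : 1 ≤ p)
    {g : EuclideanSpace ℝ (Fin d) → ℝ} (hg : ContDiff ℝ (⊤ : ℕ∞) g) {B : ℝ≥0∞}
    (h₀ : wLp δ p g ≤ B) (h₁ : ∀ i, wLp δ p (pd i g) ≤ B) :
    eLpNorm (fderiv ℝ fun x => jb x ^ δ * g x) p volume ≤ (‖δ‖₊ + d : ℝ≥0) * B := by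
  have hw := contDiff_jb_rpow (d := d) δ
  have hmeas : ∀ {u : EuclideanSpace ℝ (Fin d) → ℝ}, ContDiff ℝ (⊤ : ℕ∞) u →
      AEStronglyMeasurable (fun x => ‖jb x ^ δ * u x‖) volume :=
    fun hu => (hw.continuous.mul hu.continuous).norm.aestronglyMeasurable
  have hbound : ∀ x, ‖fderiv ℝ (fun x => jb x ^ δ * g x) x‖ ≤
      (|δ| • (fun y => ‖jb y ^ δ * g y‖) + ∑ i, fun y => ‖jb y ^ δ * pd i g y‖) x := by
    intro x
    have hx := Real.rpow_pos_of_pos (jb_pos x) δ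
    rw [fderiv_fun_mul (hw.differentiable (by simp) x) (hg.differentiable (by simp) x)]
    refine (norm_add_le _ _).trans ?_
    simp only [norm_smul, Pi.add_apply, Pi.smul_apply, smul_eq_mul, Finset.sum_apply, norm_mul,
      Real.norm_eq_abs, abs_of_pos hx]
    rw [← Finset.mul_sum, add_comm]
    refine add_le_add ?_ (mul_le_mul_of_nonneg_left (norm_fderiv_le_sum_abs_pd g x) hx.le)
    calc |g x| * _ ≤ |g x| * (|δ| * jb x ^ δ) := by
          gcongr
          exact norm_fderiv_jb_rpow_le δ x
      _ = _ := by ring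
  have hp' : (1 : ℝ≥0∞) ≤ p := by exact_mod_cast hp
  calc eLpNorm (fderiv ℝ fun x => jb x ^ δ * g x) p volume
      ≤ _ := eLpNorm_mono_real hbound
    _ ≤ _ := eLpNorm_add_le ((hmeas hg).const_smul _)
        (Finset.aestronglyMeasurable_sum _ fun i _ => hmeas (hg.pd i)) hp'
    _ ≤ ‖δ‖ₑ * wLp δ p g + ∑ i, wLp δ p (pd i g) := by
        gcongr
        · rw [eLpNorm_const_smul, eLpNorm_norm, wLp]
          simp
        · refine (eLpNorm_sum_le (fun i _ => hmeas (hg.pd i)) hp').trans (le_of_eq ?_)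
          simp only [eLpNorm_norm, wLp]
    _ ≤ ‖δ‖ₑ * B + ∑ _i : Fin d, B := by
        gcongr with i
        exact h₁ i
    _ = _ := by
        simp [add_mul, enorm_eq_nnnorm]

lemma exists_wLp_le_of_subcritical {d : ℕ} (hd : 0 < d) (δ : ℝ) {p r : ℝ≥0} (hp : 1 ≤ p)
    (hr : (r : ℝ)⁻¹ = p⁻¹ - (d : ℝ)⁻¹) :
    ∃ C : ℝ≥0, ∀ g : EuclideanSpace ℝ (Fin d) → ℝ, ContDiff ℝ (⊤ : ℕ∞) g →
      HasCompactSupport g → ∀ B : ℝ≥0∞, wLp δ p g ≤ B → (∀ i, wLp δ p (pd i g) ≤ B) →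
      wLp δ r g ≤ C * B := by
  refine ⟨eLpNormLESNormFDerivOfEqInnerConst
    (volume : Measure (EuclideanSpace ℝ (Fin d))) p * (‖δ‖₊ + d), fun g hg hgc B h₀ h₁ => ?_⟩
  have hu : ContDiff ℝ 1 fun x => jb x ^ δ * g x :=
    ((contDiff_jb_rpow δ).mul hg).of_le (by simp)
  have := eLpNorm_le_eLpNorm_fderiv_of_eq_inner volume hu hgc.mul_left hp
    (by simpa using hd) (by simpa using hr)
  rw [ENNReal.coe_mul, mul_assoc]
  exact this.trans (by gcongr; exact eLpNorm_fderiv_jb_rpow_mul_le δ hp hg h₀ h₁)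

lemma exists_wLp_le_of_mul_lt {d : ℕ} (hd : 0 < d) (δ : ℝ) {p : ℝ≥0} (hp : 1 ≤ p) (m : ℕ)
    (r : ℝ≥0) (hr₀ : r ≠ 0) (hr : (r : ℝ)⁻¹ = p⁻¹ - m / d) :
    ∃ C : ℝ≥0, ∀ f : EuclideanSpace ℝ (Fin d) → ℝ, ContDiff ℝ (⊤ : ℕ∞) f →
      HasCompactSupport f → ∀ B : ℝ≥0∞,
      (∀ l : List (Fin d), l.length ≤ m → wLp δ p (pdList l f) ≤ B) → wLp δ r f ≤ C * B := by
  induction m generalizing r with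
  | zero =>
    have : r = p := by
      apply NNReal.coe_injective
      simpa using hr
    subst this
    exact ⟨1, fun f _ _ B h => by simpa [pdList] using h [] le_rfl⟩
  | succ m ih =>
    have hd' : (0 : ℝ) < d := by exact_mod_cast hd
    have hspos : (0 : ℝ) < (r : ℝ)⁻¹ + (d : ℝ)⁻¹ := by positivity
    set s : ℝ≥0 := (r⁻¹ + (d : ℝ≥0)⁻¹)⁻¹ with hs
    have hsr : (s : ℝ)⁻¹ = (r : ℝ)⁻¹ + (d : ℝ)⁻¹ := by simp [hs]
    have hsp : (s : ℝ)⁻¹ = (p : ℝ)⁻¹ - m / d := by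
      rw [hsr, hr]
      push_cast
      ring
    have hs₀ : s ≠ 0 := by
      rintro h
      rw [h] at hsr
      simp only [NNReal.coe_zero, inv_zero] at hsr
      exact hspos.ne hsr
    have hs₁ : 1 ≤ s := by
      refine hp.trans ?_
      have hp₀ : (0 : ℝ) < p := lt_of_lt_of_le one_pos (by exact_mod_cast hp)
      have hs₂ : (0 : ℝ) < s := by positivity
      rw [← NNReal.coe_le_coe, ← inv_le_inv₀ hs₂ hp₀, hsp]
      simp only [sub_le_self_iff]
      positivity
    obtain ⟨C, hC⟩ := ih s hs₀ hsp
    obtain ⟨C', hC'⟩ := exists_wLp_le_of_subcritical hd δ hs₁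
      (r := r) (by rw [NNReal.coe_inv, hsr]; ring)
    refine ⟨C' * C, fun f hf hfc B hB => ?_⟩
    rw [ENNReal.coe_mul, mul_assoc]
    refine hC' f hf hfc _ (hC f hf hfc B fun l hl => hB l (by lia)) fun i =>
      hC _ (hf.pd i) (hfc.pd i) B fun l hl => ?_
    rw [← pdList_append_singleton]
    exact hB _ (by simpa using hl)

lemma eLpNorm_le_of_le_of_le {α : Type*} [MeasurableSpace α] {μ : Measure α} {u : α → ℝ}
    (hu : AEStronglyMeasurable u μ) {p q r : ℝ≥0} (hp : p ≠ 0) (hpq : p ≤ q) (hqr : q ≤ r)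
    {B : ℝ≥0∞} (h₁ : eLpNorm u p μ ≤ B) (h₂ : eLpNorm u r μ ≤ B) : eLpNorm u q μ ≤ B := by
  rcases hpq.eq_or_lt with rfl | hpq'
  · exact h₁
  have hp' : (0 : ℝ) < p := by positivity
  have hpq₂ : (p : ℝ) < q := by exact_mod_cast hpq'
  have hqr₂ : (q : ℝ) ≤ r := by exact_mod_cast hqr
  have hq' : (0 : ℝ) < q := hp'.trans hpq₂
  have hr' : (0 : ℝ) < r := hq'.trans_le hqr₂
  have hpr : (0 : ℝ) < r - p := by linarith
  have hpow : ∀ {s : ℝ≥0}, (0 : ℝ) < s →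
      (eLpNorm u s μ ≤ B ↔ ∫⁻ x, ‖u x‖ₑ ^ (s : ℝ) ∂μ ≤ B ^ (s : ℝ)) := by
    intro s hs
    rw [← eLpNorm_nnreal_pow_eq_lintegral (by exact_mod_cast hs.ne'), ENNReal.rpow_le_rpow_iff hs]
  rw [hpow hp'] at h₁
  rw [hpow hr'] at h₂
  rw [hpow hq']
  set a : ℝ := (r - q) / (r - p) with ha
  set b : ℝ := (q - p) / (r - p) with hb
  have ha₀ : 0 ≤ a := div_nonneg (by linarith) hpr.le
  have hb₀ : 0 ≤ b := div_nonneg (by linarith) hpr.le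
  have hab : a + b = 1 := by
    rw [ha, hb]
    field_simp
    ring
  have hq : (q : ℝ) = p * a + r * b := by
    rw [ha, hb]
    field_simp
    ring
  have hsplit : ∀ t : ℝ≥0∞, (t ^ (p : ℝ)) ^ a * (t ^ (r : ℝ)) ^ b = t ^ (q : ℝ) := by
    intro t
    rw [← ENNReal.rpow_mul, ← ENNReal.rpow_mul, ← ENNReal.rpow_add_of_nonneg _ _
      (by positivity) (by positivity), hq]
  calc ∫⁻ x, ‖u x‖ₑ ^ (q : ℝ) ∂μ
      = ∫⁻ x, (‖u x‖ₑ ^ (p : ℝ)) ^ a * (‖u x‖ₑ ^ (r : ℝ)) ^ b ∂μ := by simp_rw [hsplit]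
    _ ≤ (∫⁻ x, ‖u x‖ₑ ^ (p : ℝ) ∂μ) ^ a * (∫⁻ x, ‖u x‖ₑ ^ (r : ℝ) ∂μ) ^ b :=
        ENNReal.lintegral_mul_norm_pow_le (hu.enorm.pow_const _) (hu.enorm.pow_const _)
          ha₀ hb₀ hab
    _ ≤ (B ^ (p : ℝ)) ^ a * (B ^ (r : ℝ)) ^ b := by gcongr
    _ = _ := hsplit B

/-- Critical Sobolev embedding `W^{1,n} ⊆ L^{kn'}` for `k ≥ n - 1`, where `n'` is the conjugate
exponent of the dimension `n`. -/
lemma exists_eLpNorm_le_of_critical {d : ℕ} {n' : ℝ≥0} (hd : NNReal.HolderConjugate d n')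
    (k : ℕ) (hk : d - 1 ≤ k) :
    ∃ C : ℝ≥0, ∀ u : EuclideanSpace ℝ (Fin d) → ℝ, ContDiff ℝ 1 u → HasCompactSupport u →
      ∀ B : ℝ≥0∞, eLpNorm u (d : ℝ≥0) volume ≤ B →
        eLpNorm (fderiv ℝ u) (d : ℝ≥0) volume ≤ B →
        eLpNorm u (k * n' : ℝ≥0) volume ≤ C * B := by
  have hd₁ : 1 < d := by exact_mod_cast hd.lt
  induction k, hk using Nat.le_induction with
  | base =>
    refine ⟨1, fun u _ _ B h _ => ?_⟩
    have : ((d - 1 : ℕ) : ℝ≥0) * n' = d := by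
      rw [Nat.cast_tsub, Nat.cast_one]
      exact hd.sub_one_mul_conj
    rw [this]
    simpa using h
  | succ k hk ih =>
    obtain ⟨C, hC⟩ := ih
    have hk₀ : 0 < k := by lia
    set K := eLpNormLESNormFDerivOneConst (volume : Measure (EuclideanSpace ℝ (Fin d))) n'
    refine ⟨(K * (k + 1) * C ^ k) ^ ((k + 1 : ℝ)⁻¹), fun u hu huc B h₀ h₁ => ?_⟩
    have hku := hC u hu huc B h₀ h₁
    have hpow : ∀ (j : ℕ), 0 < j →
        eLpNorm (fun x => u x ^ j) n' volume = eLpNorm u (j * n' : ℝ≥0) volume ^ j := by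
      intro j hj
      have hj' : (0 : ℝ) < j := by exact_mod_cast hj
      have := eLpNorm_norm_rpow u (p := n') (μ := volume) hj'
      rw [ENNReal.rpow_natCast] at this
      rw [← eLpNorm_norm]
      simp only [norm_pow]
      simp only [Real.rpow_natCast] at this
      rw [this]
      congr 2
      rw [mul_comm]
      simp
    have hv : ContDiff ℝ 1 fun x => u x ^ (k + 1) := hu.pow _
    have hvc : HasCompactSupport fun x => u x ^ (k + 1) :=
      huc.comp_left (g := fun t : ℝ => t ^ (k + 1)) (by simp)
    have hG := eLpNorm_le_eLpNorm_fderiv_one volume hv hvc (p := n') (by simpa using hd)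
    have hder : ∀ x, fderiv ℝ (fun x => u x ^ (k + 1)) x =
        ((k + 1 : ℝ) • ((fun x => u x ^ k) • fderiv ℝ u)) x := by
      intro x
      rw [fderiv_fun_pow _ (hu.differentiable one_ne_zero x)]
      simp [mul_smul]
    have hHolder : eLpNorm ((fun x => u x ^ k) • fderiv ℝ u) 1 volume ≤
        eLpNorm (fun x => u x ^ k) n' volume * eLpNorm (fderiv ℝ u) (d : ℝ≥0) volume := by
      have : ENNReal.HolderConjugate n' (d : ℝ≥0) := hd.symm.coe_ennreal
      exact eLpNorm_smul_le_mul_eLpNorm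
        (hu.continuous_fderiv one_ne_zero).aestronglyMeasurable
        (hu.continuous.pow k).aestronglyMeasurable
    have hmain : eLpNorm u ((k + 1 : ℕ) * n' : ℝ≥0) volume ^ (k + 1) ≤
        (K * (k + 1) * C ^ k : ℝ≥0) * B ^ (k + 1) := by
      rw [← hpow (k + 1) k.succ_pos]
      refine hG.trans ?_
      rw [funext hder]
      have hc : ‖(k + 1 : ℝ)‖ₑ = ((k + 1 : ℝ≥0) : ℝ≥0∞) := by
        rw [enorm_eq_nnnorm]
        congr 1
        ext
        simpa using abs_of_pos (by positivity : (0 : ℝ) < k + 1)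
      calc (K : ℝ≥0∞) * eLpNorm ((k + 1 : ℝ) • ((fun x => u x ^ k) • fderiv ℝ u)) 1 volume
          = K * (((k + 1 : ℝ≥0) : ℝ≥0∞) *
              eLpNorm ((fun x => u x ^ k) • fderiv ℝ u) 1 volume) := by
            rw [← hc]
            congr 1
            exact eLpNorm_const_smul (k + 1 : ℝ) ((fun x => u x ^ k) • fderiv ℝ u) 1 volume
        _ ≤ K * (((k + 1 : ℝ≥0) : ℝ≥0∞) * ((C * B) ^ k * B)) := by
            gcongr
            refine hHolder.trans ?_
            rw [hpow k hk₀]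
            gcongr
        _ = _ := by
            push_cast
            ring
    have hk1 : (0 : ℝ) < k + 1 := by positivity
    rw [← ENNReal.rpow_le_rpow_iff hk1, ENNReal.mul_rpow_of_nonneg _ _ hk1.le,
      ← ENNReal.coe_rpow_of_nonneg _ hk1.le, ← NNReal.rpow_mul, inv_mul_cancel₀ hk1.ne',
      NNReal.rpow_one]
    have hcast : (k + 1 : ℝ) = ((k + 1 : ℕ) : ℝ) := by push_cast; rfl
    rw [hcast, ENNReal.rpow_natCast, ENNReal.rpow_natCast]
    exact hmain

lemma exists_wLp_le_of_mul_eq {d : ℕ} (δ : ℝ) {p : ℝ≥0} (hp : 1 < p) (m : ℕ) (hd : 0 < d)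
    (hm : (m : ℝ) * p = d) (q : ℝ) :
    ∃ r : ℝ≥0, q ≤ r ∧ ∃ C : ℝ≥0, ∀ f : EuclideanSpace ℝ (Fin d) → ℝ,
      ContDiff ℝ (⊤ : ℕ∞) f → HasCompactSupport f → ∀ B : ℝ≥0∞,
      (∀ l : List (Fin d), l.length ≤ m → wLp δ p (pdList l f) ≤ B) → wLp δ r f ≤ C * B := by
  have hd' : (0 : ℝ) < d := by exact_mod_cast hd
  have hp₁ : (1 : ℝ) < p := by exact_mod_cast hp
  obtain _ | m := m
  · simp only [Nat.cast_zero, zero_mul] at hm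
    exact absurd hm hd'.ne
  have hd₁ : 1 < d := by
    have : (1 : ℝ) < d := by
      rw [← hm]
      push_cast
      nlinarith [(Nat.cast_nonneg m : (0 : ℝ) ≤ m)]
    exact_mod_cast this
  have hconj : NNReal.HolderConjugate d (NNReal.conjExponent d) :=
    .conjExponent (by exact_mod_cast hd₁)
  obtain ⟨k, hk⟩ := exists_nat_ge (max q d)
  have hkd : d ≤ k := by exact_mod_cast (le_max_right _ _).trans hk
  obtain ⟨C, hC⟩ := exists_eLpNorm_le_of_critical hconj k (by lia)
  obtain ⟨C', hC'⟩ := exists_wLp_le_of_mul_lt hd δ hp.le m d (by exact_mod_cast hd.ne') (by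
    have : (p : ℝ) ≠ 0 := by positivity
    push_cast at hm ⊢
    rw [← hm]
    have : (m + 1 : ℝ) ≠ 0 := by positivity
    field_simp
    ring)
  refine ⟨k * NNReal.conjExponent d, ?_, C * max C' ((‖δ‖₊ + d) * C'), fun f hf hfc B hB => ?_⟩
  · have h1 : (1 : ℝ) ≤ NNReal.conjExponent d := by exact_mod_cast hconj.symm.lt.le
    push_cast
    nlinarith [(le_max_left _ _).trans hk, (Nat.cast_nonneg k : (0 : ℝ) ≤ k)]
  · have h₀ : wLp δ d f ≤ C' * B := hC' f hf hfc B fun l hl => hB l (by lia)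
    have h₁ : ∀ i, wLp δ d (pd i f) ≤ C' * B := fun i =>
      hC' _ (hf.pd i) (hfc.pd i) B fun l hl => by
        rw [← pdList_append_singleton]
        exact hB _ (by simpa using hl)
    rw [ENNReal.coe_mul, mul_assoc]
    refine hC _ (((contDiff_jb_rpow δ).mul hf).of_le (by simp)) hfc.mul_left _ ?_ ?_
    · refine h₀.trans ?_
      gcongr
      exact le_max_left _ _
    · refine (eLpNorm_fderiv_jb_rpow_mul_le δ (by exact_mod_cast hd₁.le) hf h₀ h₁).trans ?_
      rw [← mul_assoc, ← ENNReal.coe_mul]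
      gcongr
      exact le_max_right _ _

/-- Weighted Sobolev inequality for the spaces `H^{m,p}_δ(ℝ^d)`:
if `mp < d` and `p ≤ q ≤ dp/(d-mp)`, or `mp = d` and `p ≤ q < ∞`, then
`‖f‖_{L^q_δ} ≤ C ‖f‖_{H^{m,p}_δ}` for all `f ∈ C_c^∞(ℝ^d)`. -/
theorem weighted_H_sobolev_inequality
    (d m : ℕ) (hd : 1 ≤ d) (p q δ : ℝ) (hp : 1 < p)
    (hcase : ((m : ℝ) * p < d ∧ p ≤ q ∧ q ≤ d * p / (d - m * p)) ∨
             ((m : ℝ) * p = d ∧ p ≤ q)) :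
    ∃ C : ℝ, 0 < C ∧ ∀ f : EuclideanSpace ℝ (Fin d) → ℝ,
      ContDiff ℝ (⊤ : ℕ∞) f → HasCompactSupport f →
      (∫ x, (jb x ^ δ * |f x|) ^ q) ^ (1 / q) ≤
        C * ∑ α ∈ mIdx d m, (∫ x, (jb x ^ δ * |mD α f x|) ^ p) ^ (1 / p) := by
  have hd₀ : 0 < d := hd
  have hd' : (0 : ℝ) < d := by exact_mod_cast hd₀
  lift p to ℝ≥0 using by linarith
  have hp₁ : 1 < p := by exact_mod_cast hp
  have hp₀ : p ≠ 0 := (zero_lt_one.trans hp₁).ne'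
  have hp' : (0 : ℝ) < p := by linarith
  have hpq : (p : ℝ) ≤ q := by
    rcases hcase with h | h
    exacts [h.2.1, h.2]
  lift q to ℝ≥0 using by linarith
  have hpq' : p ≤ q := by exact_mod_cast hpq
  have hq₀ : q ≠ 0 := (zero_lt_one.trans (hp₁.trans_le hpq')).ne'
  obtain ⟨r, hqr, C, hC⟩ : ∃ r : ℝ≥0, (q : ℝ) ≤ r ∧ ∃ C : ℝ≥0,
      ∀ f : EuclideanSpace ℝ (Fin d) → ℝ, ContDiff ℝ (⊤ : ℕ∞) f → HasCompactSupport f →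
      ∀ B : ℝ≥0∞, (∀ l : List (Fin d), l.length ≤ m → wLp δ p (pdList l f) ≤ B) →
        wLp δ r f ≤ C * B := by
    rcases hcase with ⟨hlt, -, hle⟩ | ⟨heq, -⟩
    · have hpos : 0 < d - m * (p : ℝ) := by linarith
      have hr : 0 < d * (p : ℝ) / (d - m * p) := by positivity
      refine ⟨⟨_, hr.le⟩, hle, exists_wLp_le_of_mul_lt hd₀ δ hp₁.le m _ ?_ ?_⟩
      · exact fun h => hr.ne' (congrArg NNReal.toReal h)
      · change ((d : ℝ) * p / (d - m * p))⁻¹ = ((p⁻¹ : ℝ≥0) : ℝ) - m / d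
        rw [NNReal.coe_inv]
        field_simp
    · exact exists_wLp_le_of_mul_eq δ hp₁ m hd₀ heq q
  refine ⟨(max C 1 : ℝ≥0), by positivity, fun f hf hfc => ?_⟩
  have hsmooth : ∀ α, ContDiff ℝ (⊤ : ℕ∞) (mD α f) := fun α => hf.pdList _
  have hsupp : ∀ α, HasCompactSupport (mD α f) := fun α => hfc.pdList _
  have hfin : ∀ α, wLp δ p (mD α f) ≠ ∞ := fun α =>
    (memLp_jb_rpow_mul δ p (hsmooth α).continuous (hsupp α)).eLpNorm_ne_top
  set B := ∑ α ∈ mIdx d m, wLp δ p (mD α f) with hB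
  have hBfin : B ≠ ∞ := ENNReal.sum_ne_top.2 fun α _ => hfin α
  have hlist : ∀ l : List (Fin d), l.length ≤ m → wLp δ p (pdList l f) ≤ B := by
    intro l hl
    rw [← mD_count_eq_pdList hf l]
    exact Finset.single_le_sum (f := fun α => wLp δ p (mD α f)) (fun _ _ => zero_le)
      (count_mem_mIdx hl)
  have hmain : wLp δ q f ≤ (max C 1 : ℝ≥0) * B := by
    refine eLpNorm_le_of_le_of_le
      ((contDiff_jb_rpow δ).continuous.mul hf.continuous).aestronglyMeasurable hp₀ hpq'
      (by exact_mod_cast hqr) ?_ ?_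
    · refine (hlist [] (Nat.zero_le _)).trans (le_mul_of_one_le_left zero_le ?_)
      exact_mod_cast le_max_right C 1
    · refine (hC f hf hfc B hlist).trans ?_
      gcongr
      exact le_max_left _ _
  rw [toReal_wLp δ hq₀ hf.continuous hfc]
  simp_rw [fun α => toReal_wLp δ hp₀ (hsmooth α).continuous (hsupp α)]
  rw [← ENNReal.toReal_sum fun α _ => hfin α, ← hB]
  have := ENNReal.toReal_mono (ENNReal.mul_ne_top ENNReal.coe_ne_top hBfin) hmain
  rwa [ENNReal.toReal_mul, ENNReal.coe_toReal] at this
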